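/- arXiv:2509.12538 — 4 statements merged into one kernel-verified Lean document; each statement's English description precedes it below -/
import Mathlib

section
/- Partial identification of the direct effect with treated peer, pairs (Lemma 1, part 2). Assume Assumptions IV, SM and IRR hold and P(D_i(1,1) > D_i(0,1), D_p(1,1) = 1) > 0, so that τ_D(1) = E[Y_i(1,1) − Y_i(0,1) | D_i(1,1) > D_i(0,1), D_p(1,1) = 1] is well defined. Define L = Δ^{11}_{01}E[Y_i D_p] / Δ^{11}_{01}E[D_i D_p] − (E[Y_i D_i D_p | Z=(0,0)] / E[D_i D_p | Z=(0,0)]) · (Δ^{11}_{01}E[D_p] / Δ^{11}_{01}E[D_i D_p]) and U = Δ^{11}_{01}E[Y_i D_p] / Δ^{11}_{01}E[D_i D_p] − (Δ^{11}_{10}E[Y_i(1−D_i)D_p] / Δ^{11}_{10}E[(1−D_i)D_p]) · (Δ^{11}_{01}E[D_p] / Δ^{11}_{01}E[D_i D_p]). Then: (a) if P(D_i(0,0)=1, D_p(0,0)=1) > 0 and E[Y_i(1,1) | D_i(0,0)=1, D_p(0,0)=1] ≥ E[Y_i(0,1) | D_i(1,1) > D_i(0,1), D_p(1,1) > D_p(0,1)],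 then L ≤ τ_D(1); (b) if P(D_i(1,1)=0, D_p(1,1) > D_p(1,0)) > 0 and E[Y_i(0,1) | D_i(1,1) > D_i(0,1), D_p(1,1) > D_p(0,1)] ≥ E[Y_i(0,1) | D_i(1,1)=0, D_p(1,1) > D_p(1,0)], then τ_D(1) ≤ U. -/
open MeasureTheory ProbabilityTheory

noncomputable section

/-- Real value of a Boolean indicator. -/
def b2r (b : Bool) : ℝ := if b then 1 else 0

variable {Ω : Type*}

/-- Conditional expectation of `X` given the event `A`, i.e. `E[X·1_A]/P(A)`. -/
def cexp [MeasurableSpace Ω] (P : Measure Ω) (X : Ω → ℝ) (A : Set Ω) : ℝ :=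
  (∫ ω in A, X ω ∂P) / (P A).toReal

/-- The event `{Z_i = z, Z_p = z'}`. -/
def Zev (Zi Zp : Ω → Bool) (z z' : Bool) : Set Ω := {ω | Zi ω = z ∧ Zp ω = z'}

/-- `Δ^{zz'}_{ww'} E[X]`. -/
def dE [MeasurableSpace Ω] (P : Measure Ω) (Zi Zp : Ω → Bool) (X : Ω → ℝ)
    (z z' w w' : Bool) : ℝ :=
  cexp P X (Zev Zi Zp z z') - cexp P X (Zev Zi Zp w w')

lemma measurable_b2r : Measurable b2r := measurable_of_finite _

/-- Conditioning on an event about `V` does not change the mean of a function of an independent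
variable `W`. -/
lemma cexp_preimage_of_indepFun [MeasurableSpace Ω] {P : Measure Ω} [IsProbabilityMeasure P]
    {α β : Type*} [MeasurableSpace α] [MeasurableSpace β] {V : Ω → α} {W : Ω → β}
    (hVW : IndepFun V W P) (hV : Measurable V) (hW : Measurable W) {S : Set α}
    (hS : MeasurableSet S) (hpos : 0 < P (V ⁻¹' S)) {X : Ω → ℝ} {φ : β → ℝ} (hφ : Measurable φ)
    (hX : ∀ ω ∈ V ⁻¹' S, X ω = φ (W ω)) :
    cexp P X (V ⁻¹' S) = ∫ ω, φ (W ω) ∂P := by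
  have hne : (P (V ⁻¹' S)).toReal ≠ 0 :=
    (ENNReal.toReal_pos hpos.ne' (measure_ne_top _ _)).ne'
  have hprod := hVW.integral_fun_comp_mul_comp (f := S.indicator (fun _ => (1 : ℝ))) (g := φ)
    hV.aemeasurable hW.aemeasurable
    (measurable_const.indicator hS).aestronglyMeasurable hφ.aestronglyMeasurable
  have hprob : ∫ ω, S.indicator (fun _ => (1 : ℝ)) (V ω) ∂P = (P (V ⁻¹' S)).toReal :=
    integral_indicator_one (μ := P) (hV hS)
  have hset : ∫ ω in V ⁻¹' S, X ω ∂P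
      = ∫ ω, S.indicator (fun _ => (1 : ℝ)) (V ω) * φ (W ω) ∂P := by
    rw [setIntegral_congr_fun (hV hS) hX, ← integral_indicator (hV hS)]
    refine integral_congr_ae (ae_of_all _ fun ω => ?_)
    by_cases h : V ω ∈ S <;> simp [h]
  rw [cexp, hset, hprod, hprob]
  field_simp

lemma measurable_comp_treatments {g : Bool → Bool → ℝ → ℝ} (hg : ∀ a b, Measurable (g a b)) :
    Measurable fun p : (Bool × Bool) × (Bool → Bool → ℝ) =>
      g p.1.1 p.1.2 (p.2 p.1.1 p.1.2) := by
  refine measurable_from_prod_countable_right fun a => ?_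
  have heval : Measurable fun y : Bool → Bool → ℝ => y a.1 a.2 :=
    (measurable_pi_apply a.2).comp (measurable_pi_apply a.1)
  exact (hg a.1 a.2).comp heval

lemma integrable_comp_treatments [MeasurableSpace Ω] {P : Measure Ω} [IsFiniteMeasure P]
    {A B : Ω → Bool} {Y : Bool → Bool → Ω → ℝ} (hA : Measurable A) (hB : Measurable B)
    (hYm : ∀ d d', Measurable (Y d d')) (hYint : ∀ d d', Integrable (Y d d') P)
    {g : Bool → Bool → ℝ → ℝ} (hg : ∀ a b, Measurable (g a b))
    (hgb : ∀ a b y, |g a b y| ≤ |y| + 1) :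
    Integrable (fun ω => g (A ω) (B ω) (Y (A ω) (B ω) ω)) P := by
  have hbound : Integrable (fun ω => ∑ a, ∑ b, |Y a b ω| + 1) P :=
    (integrable_finsetSum _ fun a _ => integrable_finsetSum _ fun b _ => (hYint a b).abs).add
      (integrable_const _)
  refine hbound.mono' ?_ (ae_of_all _ fun ω => ?_)
  · exact ((measurable_comp_treatments hg).comp ((hA.prodMk hB).prodMk
      (measurable_pi_lambda _ fun d => measurable_pi_lambda _ fun d' =>
        hYm d d'))).aestronglyMeasurable
  · refine (hgb _ _ _).trans (add_le_add_left ?_ 1)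
    exact (Finset.single_le_sum (f := fun b => |Y (A ω) b ω|) (fun _ _ => abs_nonneg _)
      (Finset.mem_univ (B ω))).trans
      (Finset.single_le_sum (f := fun a => ∑ b, |Y a b ω|)
        (fun _ _ => Finset.sum_nonneg fun _ _ => abs_nonneg _) (Finset.mem_univ (A ω)))

section PotentialOutcomes

variable [MeasurableSpace Ω] {P : Measure Ω} [IsProbabilityMeasure P]
  {Zi Zp : Ω → Bool} {Di Dp : Bool → Bool → Ω → Bool} {Y : Bool → Bool → Ω → ℝ}
  {DiO DpO : Ω → Bool} {YO : Ω → ℝ}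

/-- The mean of an observed quantity given the instruments is the mean of the corresponding
potential quantity. -/
lemma cexp_Zev_eq_integral
    (hZi : Measurable Zi) (hZp : Measurable Zp)
    (hDi : ∀ z z', Measurable (Di z z')) (hDp : ∀ z z', Measurable (Dp z z'))
    (hYm : ∀ d d', Measurable (Y d d'))
    (hZpos : ∀ z z', 0 < P (Zev Zi Zp z z'))
    (hIndep : IndepFun (fun ω => (Zi ω, Zp ω))
      (fun ω => ((fun z z' => Di z z' ω, fun z z' => Dp z z' ω),
        fun d d' => Y d d' ω)) P)
    (hDiO : ∀ ω, DiO ω = Di (Zi ω) (Zp ω) ω)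
    (hDpO : ∀ ω, DpO ω = Dp (Zi ω) (Zp ω) ω)
    (hYO : ∀ ω, YO ω = Y (DiO ω) (DpO ω) ω)
    {g : Bool → Bool → ℝ → ℝ} (hg : ∀ a b, Measurable (g a b)) (z z' : Bool) :
    cexp P (fun ω => g (DiO ω) (DpO ω) (YO ω)) (Zev Zi Zp z z')
      = ∫ ω, g (Di z z' ω) (Dp z z' ω) (Y (Di z z' ω) (Dp z z' ω) ω) ∂P := by
  have hZev : Zev Zi Zp z z' = (fun ω => (Zi ω, Zp ω)) ⁻¹' {(z, z')} := by
    ext ω; simp [Zev]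
  have hpos := hZpos z z'
  rw [hZev] at hpos ⊢
  refine cexp_preimage_of_indepFun hIndep (hZi.prodMk hZp) ?_ (measurableSet_singleton _) hpos
    (φ := fun w => g (w.1.1 z z') (w.1.2 z z') (w.2 (w.1.1 z z') (w.1.2 z z'))) ?_ ?_
  · exact ((measurable_pi_lambda _ fun z => measurable_pi_lambda _ fun z' => hDi z z').prodMk
      (measurable_pi_lambda _ fun z => measurable_pi_lambda _ fun z' => hDp z z')).prodMk
      (measurable_pi_lambda _ fun d => measurable_pi_lambda _ fun d' => hYm d d')
  · refine (measurable_comp_treatments hg).comp (Measurable.prodMk (Measurable.prodMk ?_ ?_) ?_)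
    · exact (measurable_pi_apply z').comp ((measurable_pi_apply z).comp
        (measurable_fst.comp measurable_fst))
    · exact (measurable_pi_apply z').comp ((measurable_pi_apply z).comp
        (measurable_snd.comp measurable_fst))
    · exact measurable_snd
  · intro ω hω
    obtain ⟨rfl, rfl⟩ : Zi ω = z ∧ Zp ω = z' := by simpa using hω
    simp only [hYO, hDiO, hDpO]

lemma dE_eq_integral
    (hZi : Measurable Zi) (hZp : Measurable Zp)
    (hDi : ∀ z z', Measurable (Di z z')) (hDp : ∀ z z', Measurable (Dp z z'))
    (hYm : ∀ d d', Measurable (Y d d')) (hYint : ∀ d d', Integrable (Y d d') P)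
    (hZpos : ∀ z z', 0 < P (Zev Zi Zp z z'))
    (hIndep : IndepFun (fun ω => (Zi ω, Zp ω))
      (fun ω => ((fun z z' => Di z z' ω, fun z z' => Dp z z' ω),
        fun d d' => Y d d' ω)) P)
    (hDiO : ∀ ω, DiO ω = Di (Zi ω) (Zp ω) ω)
    (hDpO : ∀ ω, DpO ω = Dp (Zi ω) (Zp ω) ω)
    (hYO : ∀ ω, YO ω = Y (DiO ω) (DpO ω) ω)
    {g : Bool → Bool → ℝ → ℝ} (hg : ∀ a b, Measurable (g a b))
    (hgb : ∀ a b y, |g a b y| ≤ |y| + 1) {z z' w w' : Bool} {h : Ω → ℝ}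
    (hh : ∀ᵐ ω ∂P, g (Di z z' ω) (Dp z z' ω) (Y (Di z z' ω) (Dp z z' ω) ω)
      - g (Di w w' ω) (Dp w w' ω) (Y (Di w w' ω) (Dp w w' ω) ω) = h ω) :
    dE P Zi Zp (fun ω => g (DiO ω) (DpO ω) (YO ω)) z z' w w' = ∫ ω, h ω ∂P := by
  have hobs := cexp_Zev_eq_integral hZi hZp hDi hDp hYm hZpos hIndep hDiO hDpO hYO hg
  rw [dE, hobs, hobs, ← integral_sub
    (integrable_comp_treatments (hDi _ _) (hDp _ _) hYm hYint hg hgb)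
    (integrable_comp_treatments (hDi _ _) (hDp _ _) hYm hYint hg hgb)]
  exact integral_congr_ae hh

end PotentialOutcomes

/-- Lemma 1, part 2: partial identification of the direct effect `τ_D(1)` with
treated peer, in the one-peer (pairs) setting. -/
theorem direct_effect_treated_peer_pairs
    [MeasurableSpace Ω] (P : Measure Ω) [IsProbabilityMeasure P]
    (Zi Zp : Ω → Bool) (Di Dp : Bool → Bool → Ω → Bool) (Y : Bool → Bool → Ω → ℝ)
    (hZi : Measurable Zi) (hZp : Measurable Zp)
    (hDi : ∀ z z', Measurable (Di z z')) (hDp : ∀ z z', Measurable (Dp z z'))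
    (hYm : ∀ d d', Measurable (Y d d')) (hYint : ∀ d d', Integrable (Y d d') P)
    (hZpos : ∀ z z', 0 < P (Zev Zi Zp z z'))
    -- Assumption IV: independence and own-instrument monotonicity
    (hIndep : IndepFun (fun ω => (Zi ω, Zp ω))
      (fun ω => ((fun z z' => Di z z' ω, fun z z' => Dp z z' ω),
        fun d d' => Y d d' ω)) P)
    (hIV : ∀ᵐ ω ∂P, ∀ z, Di false z ω ≤ Di true z ω ∧ Dp z false ω ≤ Dp z true ω)
    -- Assumption SM: monotonicity in the spillovers
    (hSM : ∀ᵐ ω ∂P, ∀ z, Di z false ω ≤ Di z true ω ∧ Dp false z ω ≤ Dp true z ω)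
    -- Assumption IRR: irrelevance
    (hIRR : ∀ᵐ ω ∂P, ∀ z,
      (Di true z ω = Di false z ω → Dp true z ω = Dp false z ω) ∧
      (Dp z true ω = Dp z false ω → Di z true ω = Di z false ω))
    -- observed variables
    (DiO DpO : Ω → Bool) (YO : Ω → ℝ)
    (hDiO : ∀ ω, DiO ω = Di (Zi ω) (Zp ω) ω)
    (hDpO : ∀ ω, DpO ω = Dp (Zi ω) (Zp ω) ω)
    (hYO : ∀ ω, YO ω = Y (DiO ω) (DpO ω) ω)
    -- the event {D_i(1,1) > D_i(0,1), D_p(1,1) = 1} and τ_D(1)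
    (T : Set Ω)
    (hT : T = {ω | Di true true ω = true ∧ Di false true ω = false ∧
      Dp true true ω = true})
    (hTpos : 0 < P T)
    -- the event {D_i(1,1) > D_i(0,1), D_p(1,1) > D_p(0,1)}
    (CG : Set Ω)
    (hCG : CG = {ω | Di true true ω = true ∧ Di false true ω = false ∧
      Dp true true ω = true ∧ Dp false true ω = false})
    (hCGpos : 0 < P CG)
    -- the event {D_i(0,0)=1, D_p(0,0)=1}
    (AA : Set Ω)
    (hAA : AA = {ω | Di false false ω = true ∧ Dp false false ω = true})
    -- the event {D_i(1,1)=0, D_p(1,1) > D_p(1,0)}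
    (NC : Set Ω)
    (hNC : NC = {ω | Di true true ω = false ∧ Dp true true ω = true ∧
      Dp true false ω = false})
    (τ L U : ℝ)
    (hτ : τ = cexp P (fun ω => Y true true ω - Y false true ω) T)
    (hL : L =
      dE P Zi Zp (fun ω => YO ω * b2r (DpO ω)) true true false true /
        dE P Zi Zp (fun ω => b2r (DiO ω) * b2r (DpO ω)) true true false true -
      (cexp P (fun ω => YO ω * b2r (DiO ω) * b2r (DpO ω)) (Zev Zi Zp false false) /
        cexp P (fun ω => b2r (DiO ω) * b2r (DpO ω)) (Zev Zi Zp false false)) *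
      (dE P Zi Zp (fun ω => b2r (DpO ω)) true true false true /
        dE P Zi Zp (fun ω => b2r (DiO ω) * b2r (DpO ω)) true true false true))
    (hU : U =
      dE P Zi Zp (fun ω => YO ω * b2r (DpO ω)) true true false true /
        dE P Zi Zp (fun ω => b2r (DiO ω) * b2r (DpO ω)) true true false true -
      (dE P Zi Zp (fun ω => YO ω * (1 - b2r (DiO ω)) * b2r (DpO ω)) true true true false /
        dE P Zi Zp (fun ω => (1 - b2r (DiO ω)) * b2r (DpO ω)) true true true false) *
      (dE P Zi Zp (fun ω => b2r (DpO ω)) true true false true /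
        dE P Zi Zp (fun ω => b2r (DiO ω) * b2r (DpO ω)) true true false true)) :
    ((0 < P AA ∧
        cexp P (Y true true) AA ≥ cexp P (Y false true) CG) → L ≤ τ) ∧
    ((0 < P NC ∧
        cexp P (Y false true) CG ≥ cexp P (Y false true) NC) → τ ≤ U) := by
  have hTm : MeasurableSet T := by
    rw [hT]
    exact (hDi _ _ (measurableSet_singleton true)).inter
      ((hDi _ _ (measurableSet_singleton false)).inter (hDp _ _ (measurableSet_singleton true)))
  have hCGm : MeasurableSet CG := by
    rw [hCG]
    exact (hDi _ _ (measurableSet_singleton true)).inter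
      ((hDi _ _ (measurableSet_singleton false)).inter
        ((hDp _ _ (measurableSet_singleton true)).inter
          (hDp _ _ (measurableSet_singleton false))))
  have hAAm : MeasurableSet AA := by
    rw [hAA]
    exact (hDi _ _ (measurableSet_singleton true)).inter (hDp _ _ (measurableSet_singleton true))
  have hNCm : MeasurableSet NC := by
    rw [hNC]
    exact (hDi _ _ (measurableSet_singleton false)).inter
      ((hDp _ _ (measurableSet_singleton true)).inter (hDp _ _ (measurableSet_singleton false)))
  have hDpY : dE P Zi Zp (fun ω => YO ω * b2r (DpO ω)) true true false true
      = (∫ ω in T, (Y true true ω - Y false true ω) ∂P) + ∫ ω in CG, Y false true ω ∂P := by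
    have hsub : Integrable (fun ω => Y true true ω - Y false true ω) P :=
      (hYint _ _).sub (hYint _ _)
    rw [← integral_indicator hTm, ← integral_indicator hCGm, ← integral_add
      (hsub.indicator hTm) ((hYint _ _).indicator hCGm)]
    refine dE_eq_integral hZi hZp hDi hDp hYm hYint hZpos hIndep hDiO hDpO hYO
      (g := fun _ b y => y * b2r b) (fun _ _ => measurable_id.mul_const _) ?_ ?_
    · intro a b y
      cases b <;> simp [b2r]
      positivity
    · filter_upwards [hIV, hSM, hIRR] with ω h₁ h₂ h₃
      have hi := (h₁ true).1
      have hp := (h₂ true).2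
      have hr := (h₃ true).1
      simp only [hT, hCG, Set.indicator, Set.mem_ofPred_eq]
      generalize Di true true ω = a at *
      generalize Di false true ω = b at *
      generalize Dp true true ω = c at *
      generalize Dp false true ω = d at *
      revert hi hp hr
      cases a <;> cases b <;> cases c <;> cases d <;> simp [b2r]
  have hDiDp : dE P Zi Zp (fun ω => b2r (DiO ω) * b2r (DpO ω)) true true false true
      = (P T).toReal := by
    refine Eq.trans ?_ (integral_indicator_one (μ := P) hTm)
    refine dE_eq_integral hZi hZp hDi hDp hYm hYint hZpos hIndep hDiO hDpO hYO
      (g := fun a b _ => b2r a * b2r b) (fun _ _ => measurable_const) ?_ ?_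
    · intro a b y
      cases a <;> cases b <;> simp [b2r] <;> positivity
    · filter_upwards [hIV, hSM, hIRR] with ω h₁ h₂ h₃
      have hi := (h₁ true).1
      have hp := (h₂ true).2
      have hr := (h₃ true).1
      simp only [hT, Set.indicator, Set.mem_ofPred_eq]
      generalize Di true true ω = a at *
      generalize Di false true ω = b at *
      generalize Dp true true ω = c at *
      generalize Dp false true ω = d at *
      revert hi hp hr
      cases a <;> cases b <;> cases c <;> cases d <;> simp [b2r]
  have hDpCG : dE P Zi Zp (fun ω => b2r (DpO ω)) true true false true = (P CG).toReal := by
    refine Eq.trans ?_ (integral_indicator_one (μ := P) hCGm)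
    refine dE_eq_integral hZi hZp hDi hDp hYm hYint hZpos hIndep hDiO hDpO hYO
      (g := fun _ b _ => b2r b) (fun _ _ => measurable_const) ?_ ?_
    · intro a b y
      cases b <;> simp [b2r]
      positivity
    · filter_upwards [hIV, hSM, hIRR] with ω h₁ h₂ h₃
      have hi := (h₁ true).1
      have hp := (h₂ true).2
      have hr := (h₃ true).1
      simp only [hCG, Set.indicator, Set.mem_ofPred_eq]
      generalize Di true true ω = a at *
      generalize Di false true ω = b at *
      generalize Dp true true ω = c at *
      generalize Dp false true ω = d at *
      revert hi hp hr
      cases a <;> cases b <;> cases c <;> cases d <;> simp [b2r]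
  have hAAY : cexp P (fun ω => YO ω * b2r (DiO ω) * b2r (DpO ω)) (Zev Zi Zp false false)
      = ∫ ω in AA, Y true true ω ∂P := by
    rw [cexp_Zev_eq_integral hZi hZp hDi hDp hYm hZpos hIndep hDiO hDpO hYO
      (g := fun a b y => y * b2r a * b2r b)
      (fun _ _ => (measurable_id.mul_const _).mul_const _), ← integral_indicator hAAm]
    refine integral_congr_ae (ae_of_all _ fun ω => ?_)
    simp only [hAA, Set.indicator, Set.mem_ofPred_eq]
    cases Di false false ω <;> cases Dp false false ω <;> simp [b2r]
  have hAAD : cexp P (fun ω => b2r (DiO ω) * b2r (DpO ω)) (Zev Zi Zp false false)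
      = (P AA).toReal := by
    rw [cexp_Zev_eq_integral hZi hZp hDi hDp hYm hZpos hIndep hDiO hDpO hYO
      (g := fun a b _ => b2r a * b2r b) (fun _ _ => measurable_const)]
    refine Eq.trans ?_ (integral_indicator_one (μ := P) hAAm)
    refine integral_congr_ae (ae_of_all _ fun ω => ?_)
    simp only [hAA, Set.indicator, Set.mem_ofPred_eq]
    cases Di false false ω <;> cases Dp false false ω <;> simp [b2r]
  have hNCY : dE P Zi Zp (fun ω => YO ω * (1 - b2r (DiO ω)) * b2r (DpO ω)) true true true false
      = ∫ ω in NC, Y false true ω ∂P := by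
    rw [← integral_indicator hNCm]
    refine dE_eq_integral hZi hZp hDi hDp hYm hYint hZpos hIndep hDiO hDpO hYO
      (g := fun a b y => y * (1 - b2r a) * b2r b)
      (fun _ _ => (measurable_id.mul_const _).mul_const _) ?_ ?_
    · intro a b y
      cases a <;> cases b <;> simp [b2r] <;> positivity
    · filter_upwards [hIV, hSM, hIRR] with ω h₁ h₂ h₃
      have hi := (h₂ true).1
      have hp := (h₁ true).2
      have hr := (h₃ true).2
      simp only [hNC, Set.indicator, Set.mem_ofPred_eq]
      generalize Di true true ω = a at *
      generalize Di true false ω = b at *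
      generalize Dp true true ω = c at *
      generalize Dp true false ω = d at *
      revert hi hp hr
      cases a <;> cases b <;> cases c <;> cases d <;> simp [b2r]
  have hNCD : dE P Zi Zp (fun ω => (1 - b2r (DiO ω)) * b2r (DpO ω)) true true true false
      = (P NC).toReal := by
    refine Eq.trans ?_ (integral_indicator_one (μ := P) hNCm)
    refine dE_eq_integral hZi hZp hDi hDp hYm hYint hZpos hIndep hDiO hDpO hYO
      (g := fun a b _ => (1 - b2r a) * b2r b) (fun _ _ => measurable_const) ?_ ?_
    · intro a b y
      cases a <;> cases b <;> simp [b2r] <;> positivity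
    · filter_upwards [hIV, hSM, hIRR] with ω h₁ h₂ h₃
      have hi := (h₂ true).1
      have hp := (h₁ true).2
      have hr := (h₃ true).2
      simp only [hNC, Set.indicator, Set.mem_ofPred_eq]
      generalize Di true true ω = a at *
      generalize Di true false ω = b at *
      generalize Dp true true ω = c at *
      generalize Dp true false ω = d at *
      revert hi hp hr
      cases a <;> cases b <;> cases c <;> cases d <;> simp [b2r]
  have hCG0 : 0 < (P CG).toReal := ENNReal.toReal_pos hCGpos.ne' (measure_ne_top _ _)
  -- Both bounds differ from `τ` by a weighted difference of conditional means.
  have hbias (m : ℝ) : dE P Zi Zp (fun ω => YO ω * b2r (DpO ω)) true true false true /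
        dE P Zi Zp (fun ω => b2r (DiO ω) * b2r (DpO ω)) true true false true -
      m * (dE P Zi Zp (fun ω => b2r (DpO ω)) true true false true /
        dE P Zi Zp (fun ω => b2r (DiO ω) * b2r (DpO ω)) true true false true)
      = τ + (P CG).toReal / (P T).toReal * (cexp P (Y false true) CG - m) := by
    rw [hDpY, hDiDp, hDpCG, hτ, cexp, cexp]
    field_simp
    ring
  rw [hbias, hAAY, hAAD] at hL
  rw [hbias, hNCY, hNCD] at hU
  have hweight : 0 ≤ (P CG).toReal / (P T).toReal := by positivity
  constructor
  · rintro ⟨-, hle⟩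
    rw [hL]
    have := mul_nonpos_of_nonneg_of_nonpos hweight (sub_nonpos.mpr hle)
    rw [cexp.eq_def P (Y true true)] at this
    linarith
  · rintro ⟨-, hle⟩
    rw [hU]
    have := mul_nonneg hweight (sub_nonneg.mpr hle)
    rw [cexp.eq_def P (Y false true) NC] at this
    linarith

end
end

section
/- Partial identification of the spillover effect on treated individuals, pairs (Lemma 2, part 2). Assume Assumptions IV, SM and IRR hold and P(D_i(1,1) = 1, D_p(1,1) > D_p(1,0)) > 0, so that τ_S(1) = E[Y_i(1,1) − Y_i(1,0) | D_i(1,1) = 1, D_p(1,1) > D_p(1,0)] is well defined. Define L = Δ^{11}_{10}E[Y_i D_i] / Δ^{11}_{10}E[D_i D_p] − (Δ^{01}_{00}E[Y_i D_i (1−D_p)] / Δ^{01}_{00}E[D_i(1−D_p)]) · (Δ^{11}_{10}E[D_i] / Δ^{11}_{10}E[D_i D_p]) and U = Δ^{11}_{10}E[Y_i D_i] / Δ^{11}_{10}E[D_i D_p] − (E[Y_i(1−D_i)(1−D_p) | Z=(1,1)] / E[(1−D_i)(1−D_p) | Z=(1,1)]) · (Δ^{11}_{10}E[D_i] / Δ^{11}_{10}E[D_i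 D_p]). Then: (a) if P(D_i(0,0)=1, D_p(0,1) > D_p(0,0)) > 0 and E[Y_i(1,0) | D_i(0,0)=1, D_p(0,1) > D_p(0,0)] ≥ E[Y_i(1,0) | D_i(1,1) > D_i(1,0), D_p(1,1) > D_p(1,0)], then L ≤ τ_S(1); (b) if P(D_i(1,1)=0, D_p(1,1)=0) > 0 and E[Y_i(1,0) | D_i(1,1) > D_i(1,0), D_p(1,1) > D_p(1,0)] ≥ E[Y_i(0,0) | D_i(1,1)=0, D_p(1,1)=0], then τ_S(1) ≤ U. -/
open MeasureTheory ProbabilityTheory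

noncomputable section

variable {Ω : Type*}

theorem measurable_bool_select {α β : Type*} [MeasurableSpace α] [MeasurableSpace β]
    {a : α → Bool} (ha : Measurable a) {f : Bool → α → β} (hf : ∀ b, Measurable (f b)) :
    Measurable fun x => f (a x) x :=
  (measurable_from_prod_countable_left (f := fun p : α × Bool => f p.2 p.1) hf).comp
    (measurable_id.prodMk ha)

theorem integrable_bool_select {α : Type*} [MeasurableSpace α] {μ : Measure α}
    {a : α → Bool} (ha : Measurable a) {f : Bool → α → ℝ} (hf : ∀ b, Integrable (f b) μ) :
    Integrable (fun x => f (a x) x) μ := by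
  have hm (b : Bool) : MeasurableSet {x | a x = b} := ha (measurableSet_singleton b)
  refine (((hf true).indicator (hm true)).add ((hf false).indicator (hm false))).congr
    (.of_forall fun x => ?_)
  cases h : a x <;> simp [h]

/-- Conditioning on an instrument cell integrates out instruments that are independent of `W`. -/
theorem cexp_Zev_eq_integral_s3 {𝓧 : Type*} [MeasurableSpace Ω] [MeasurableSpace 𝓧]
    {P : Measure Ω} [IsProbabilityMeasure P] {Zi Zp : Ω → Bool}
    (hZi : Measurable Zi) (hZp : Measurable Zp) {W : Ω → 𝓧} (hW : Measurable W)
    (hind : IndepFun (fun ω => (Zi ω, Zp ω)) W P) {z z' : Bool}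
    (hpos : 0 < P (Zev Zi Zp z z')) {X : Ω → ℝ} {g : 𝓧 → ℝ} (hg : Measurable g)
    (hX : ∀ ω ∈ Zev Zi Zp z z', X ω = g (W ω)) :
    cexp P X (Zev Zi Zp z z') = ∫ ω, g (W ω) ∂P := by
  have hZ : Measurable fun ω => (Zi ω, Zp ω) := hZi.prodMk hZp
  have hset : Zev Zi Zp z z' = (fun ω => (Zi ω, Zp ω)) ⁻¹' {(z, z')} := by
    ext ω
    simp [Zev]
  have hms : MeasurableSet (Zev Zi Zp z z') := hset ▸ hZ (measurableSet_singleton _)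
  have hne : P.real (Zev Zi Zp z z') ≠ 0 := (ENNReal.toReal_pos hpos.ne' (measure_ne_top _ _)).ne'
  have hmul := Indep.setIntegral_eq_mul hZ.comap_le hind hW.aemeasurable
    (A := Zev Zi Zp z z') ⟨_, measurableSet_singleton (z, z'), hset.symm⟩
    hg.aestronglyMeasurable
  rw [cexp, setIntegral_congr_fun hms hX, hmul]
  exact mul_div_cancel_left₀ _ hne

theorem setIntegral_eq_cexp_mul [MeasurableSpace Ω] {P : Measure Ω} [IsFiniteMeasure P]
    {A : Set Ω} (hA : 0 < P A) (X : Ω → ℝ) : ∫ ω in A, X ω ∂P = cexp P X A * P.real A :=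
  (div_mul_cancel₀ _ (ENNReal.toReal_pos hA.ne' (measure_ne_top _ _)).ne').symm

/-- Lemma 2, part 2: partial identification of the spillover effect `τ_S(1)` on
treated individuals, in the one-peer (pairs) setting. -/
theorem spillover_effect_treated_pairs
    [MeasurableSpace Ω] (P : Measure Ω) [IsProbabilityMeasure P]
    (Zi Zp : Ω → Bool) (Di Dp : Bool → Bool → Ω → Bool) (Y : Bool → Bool → Ω → ℝ)
    (hZi : Measurable Zi) (hZp : Measurable Zp)
    (hDi : ∀ z z', Measurable (Di z z')) (hDp : ∀ z z', Measurable (Dp z z'))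
    (hYm : ∀ d d', Measurable (Y d d')) (hYint : ∀ d d', Integrable (Y d d') P)
    (hZpos : ∀ z z', 0 < P (Zev Zi Zp z z'))
    -- Assumption IV: independence and own-instrument monotonicity
    (hIndep : IndepFun (fun ω => (Zi ω, Zp ω))
      (fun ω => ((fun z z' => Di z z' ω, fun z z' => Dp z z' ω),
        fun d d' => Y d d' ω)) P)
    (hIV : ∀ᵐ ω ∂P, ∀ z, Di false z ω ≤ Di true z ω ∧ Dp z false ω ≤ Dp z true ω)
    -- Assumption SM: monotonicity in the spillovers
    (hSM : ∀ᵐ ω ∂P, ∀ z, Di z false ω ≤ Di z true ω ∧ Dp false z ω ≤ Dp true z ω)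
    -- Assumption IRR: irrelevance
    (hIRR : ∀ᵐ ω ∂P, ∀ z,
      (Di true z ω = Di false z ω → Dp true z ω = Dp false z ω) ∧
      (Dp z true ω = Dp z false ω → Di z true ω = Di z false ω))
    -- observed variables
    (DiO DpO : Ω → Bool) (YO : Ω → ℝ)
    (hDiO : ∀ ω, DiO ω = Di (Zi ω) (Zp ω) ω)
    (hDpO : ∀ ω, DpO ω = Dp (Zi ω) (Zp ω) ω)
    (hYO : ∀ ω, YO ω = Y (DiO ω) (DpO ω) ω)
    -- the event {D_i(1,1) = 1, D_p(1,1) > D_p(1,0)} and τ_S(1)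
    (T : Set Ω)
    (hT : T = {ω | Di true true ω = true ∧ Dp true true ω = true ∧
      Dp true false ω = false})
    (hTpos : 0 < P T)
    -- the event {D_i(1,1) > D_i(1,0), D_p(1,1) > D_p(1,0)}
    (PG : Set Ω)
    (hPG : PG = {ω | Di true true ω = true ∧ Di true false ω = false ∧
      Dp true true ω = true ∧ Dp true false ω = false})
    (hPGpos : 0 < P PG)
    -- the event {D_i(0,0)=1, D_p(0,1) > D_p(0,0)}
    (AC : Set Ω)
    (hAC : AC = {ω | Di false false ω = true ∧ Dp false true ω = true ∧
      Dp false false ω = false})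
    -- the event {D_i(1,1)=0, D_p(1,1)=0}
    (NN : Set Ω)
    (hNN : NN = {ω | Di true true ω = false ∧ Dp true true ω = false})
    (τ L U : ℝ)
    (hτ : τ = cexp P (fun ω => Y true true ω - Y true false ω) T)
    (hL : L =
      dE P Zi Zp (fun ω => YO ω * b2r (DiO ω)) true true true false /
        dE P Zi Zp (fun ω => b2r (DiO ω) * b2r (DpO ω)) true true true false -
      (dE P Zi Zp (fun ω => YO ω * b2r (DiO ω) * (1 - b2r (DpO ω))) false true false false /
        dE P Zi Zp (fun ω => b2r (DiO ω) * (1 - b2r (DpO ω))) false true false false) *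
      (dE P Zi Zp (fun ω => b2r (DiO ω)) true true true false /
        dE P Zi Zp (fun ω => b2r (DiO ω) * b2r (DpO ω)) true true true false))
    (hU : U =
      dE P Zi Zp (fun ω => YO ω * b2r (DiO ω)) true true true false /
        dE P Zi Zp (fun ω => b2r (DiO ω) * b2r (DpO ω)) true true true false -
      (cexp P (fun ω => YO ω * (1 - b2r (DiO ω)) * (1 - b2r (DpO ω))) (Zev Zi Zp true true) /
        cexp P (fun ω => (1 - b2r (DiO ω)) * (1 - b2r (DpO ω))) (Zev Zi Zp true true)) *
      (dE P Zi Zp (fun ω => b2r (DiO ω)) true true true false /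
        dE P Zi Zp (fun ω => b2r (DiO ω) * b2r (DpO ω)) true true true false)) :
    ((0 < P AC ∧
        cexp P (Y true false) AC ≥ cexp P (Y true false) PG) → L ≤ τ) ∧
    ((0 < P NN ∧
        cexp P (Y true false) PG ≥ cexp P (Y false false) NN) → τ ≤ U) := by
  have hW : Measurable fun ω => (((fun z z' => Di z z' ω, fun z z' => Dp z z' ω),
      fun d d' => Y d d' ω) : ((Bool → Bool → Bool) × (Bool → Bool → Bool)) ×
        (Bool → Bool → ℝ)) := by
    fun_prop
  have cell (h : Bool → Bool → ℝ → ℝ) (hh : ∀ a b, Measurable (h a b)) (z z' : Bool) :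
      cexp P (fun ω => h (DiO ω) (DpO ω) (YO ω)) (Zev Zi Zp z z') =
        ∫ ω, h (Di z z' ω) (Dp z z' ω) (Y (Di z z' ω) (Dp z z' ω) ω) ∂P := by
    refine cexp_Zev_eq_integral_s3 hZi hZp hW hIndep (hZpos z z')
      (g := fun w : ((Bool → Bool → Bool) × (Bool → Bool → Bool)) × (Bool → Bool → ℝ) =>
        h (w.1.1 z z') (w.1.2 z z') (w.2 (w.1.1 z z') (w.1.2 z z'))) ?_ ?_
    · refine measurable_bool_select
        (a := fun w : ((Bool → Bool → Bool) × (Bool → Bool → Bool)) × (Bool → Bool → ℝ) =>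
          w.1.1 z z')
        (f := fun a w => h a (w.1.2 z z') (w.2 a (w.1.2 z z'))) (by fun_prop) fun a => ?_
      exact measurable_bool_select
        (a := fun w : ((Bool → Bool → Bool) × (Bool → Bool → Bool)) × (Bool → Bool → ℝ) =>
          w.1.2 z z')
        (f := fun b w => h a b (w.2 a b)) (by fun_prop) fun b => (hh a b).comp (by fun_prop)
    · rintro ω ⟨rfl, rfl⟩
      simp only [hYO, hDiO, hDpO]
  have contrast (h : Bool → Bool → ℝ → ℝ) (hh : ∀ a b, Measurable (h a b))
      (hi : ∀ a b, Integrable (fun ω => h a b (Y a b ω)) P) (z : Bool) (k : Ω → ℝ)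
      (hk : ∀ᵐ ω ∂P, h (Di z true ω) (Dp z true ω) (Y (Di z true ω) (Dp z true ω) ω) -
        h (Di z false ω) (Dp z false ω) (Y (Di z false ω) (Dp z false ω) ω) = k ω) :
      dE P Zi Zp (fun ω => h (DiO ω) (DpO ω) (YO ω)) z true z false = ∫ ω, k ω ∂P := by
    have hint (z' : Bool) : Integrable
        (fun ω => h (Di z z' ω) (Dp z z' ω) (Y (Di z z' ω) (Dp z z' ω) ω)) P :=
      integrable_bool_select (hDi z z')
        (f := fun a ω => h a (Dp z z' ω) (Y a (Dp z z' ω) ω)) fun a =>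
        integrable_bool_select (hDp z z') (f := fun b ω => h a b (Y a b ω)) (hi a)
    rw [dE, cell h hh, cell h hh, ← integral_sub (hint true) (hint false)]
    exact integral_congr_ae hk
  have mono (z : Bool) : ∀ᵐ ω ∂P, Di z false ω ≤ Di z true ω ∧ Dp z false ω ≤ Dp z true ω ∧
      (Dp z true ω = Dp z false ω → Di z true ω = Di z false ω) := by
    filter_upwards [hIV, hSM, hIRR] with ω hIVω hSMω hIRRω
    exact ⟨(hSMω z).1, (hIVω z).2, (hIRRω z).2⟩
  have hset (a : Ω → Bool) (ha : Measurable a) (b : Bool) : MeasurableSet {ω | a ω = b} :=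
    ha (measurableSet_singleton b)
  have mT : MeasurableSet T := hT ▸
    (hset _ (hDi _ _) _).inter ((hset _ (hDp _ _) _).inter (hset _ (hDp _ _) _))
  have mPG : MeasurableSet PG := hPG ▸ (hset _ (hDi _ _) _).inter
    ((hset _ (hDi _ _) _).inter ((hset _ (hDp _ _) _).inter (hset _ (hDp _ _) _)))
  have mAC : MeasurableSet AC := hAC ▸
    (hset _ (hDi _ _) _).inter ((hset _ (hDp _ _) _).inter (hset _ (hDp _ _) _))
  have mNN : MeasurableSet NN := hNN ▸ (hset _ (hDi _ _) _).inter (hset _ (hDp _ _) _)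
  have outcome_treated : dE P Zi Zp (fun ω => YO ω * b2r (DiO ω)) true true true false =
      (∫ ω in T, (Y true true ω - Y true false ω) ∂P) + ∫ ω in PG, Y true false ω ∂P := by
    have iT : Integrable (T.indicator fun ω => Y true true ω - Y true false ω) P :=
      ((hYint _ _).sub (hYint _ _)).indicator mT
    rw [← integral_indicator mT, ← integral_indicator mPG,
      ← integral_add iT ((hYint _ _).indicator mPG)]
    refine contrast (fun a _ y => y * b2r a) (fun _ _ => by fun_prop)
      (fun _ _ => (hYint _ _).mul_const _) true _ ?_
    filter_upwards [mono true] with ω hω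
    revert hω
    cases hi₁ : Di true true ω <;> cases hi₀ : Di true false ω <;> cases hp₁ : Dp true true ω <;>
      cases hp₀ : Dp true false ω <;>
      simp [b2r, Set.indicator, hT, hPG, hi₁, hi₀, hp₁, hp₀]
  have treated : dE P Zi Zp (fun ω => b2r (DiO ω)) true true true false = P.real PG := by
    rw [← integral_indicator_one mPG]
    refine contrast (fun a _ _ => b2r a) (fun _ _ => by fun_prop)
      (fun _ _ => integrable_const _) true _ ?_
    filter_upwards [mono true] with ω hω
    revert hω
    cases hi₁ : Di true true ω <;> cases hi₀ : Di true false ω <;> cases hp₁ : Dp true true ω <;>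
      cases hp₀ : Dp true false ω <;>
      simp [b2r, Set.indicator, hPG, hi₁, hi₀, hp₁, hp₀]
  have both_treated : dE P Zi Zp (fun ω => b2r (DiO ω) * b2r (DpO ω)) true true true false =
      P.real T := by
    rw [← integral_indicator_one mT]
    refine contrast (fun a b _ => b2r a * b2r b) (fun _ _ => by fun_prop)
      (fun _ _ => integrable_const _) true _ ?_
    filter_upwards [mono true] with ω hω
    revert hω
    cases hi₁ : Di true true ω <;> cases Di true false ω <;> cases hp₁ : Dp true true ω <;>
      cases hp₀ : Dp true false ω <;>
      simp [b2r, Set.indicator, hT, hi₁, hp₁, hp₀]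
  have outcome_only_own : dE P Zi Zp (fun ω => YO ω * b2r (DiO ω) * (1 - b2r (DpO ω)))
      false true false false = -∫ ω in AC, Y true false ω ∂P := by
    rw [← integral_indicator mAC, ← integral_neg]
    refine contrast (fun a b y => y * b2r a * (1 - b2r b)) (fun _ _ => by fun_prop)
      (fun _ _ => ((hYint _ _).mul_const _).mul_const _) false _ ?_
    filter_upwards [mono false] with ω hω
    revert hω
    cases Di false true ω <;> cases hi₀ : Di false false ω <;> cases hp₁ : Dp false true ω <;>
      cases hp₀ : Dp false false ω <;>
      simp [b2r, Set.indicator, hAC, hi₀, hp₁, hp₀]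
  have only_own : dE P Zi Zp (fun ω => b2r (DiO ω) * (1 - b2r (DpO ω)))
      false true false false = -P.real AC := by
    rw [← integral_indicator_one mAC, ← integral_neg]
    refine contrast (fun a b _ => b2r a * (1 - b2r b)) (fun _ _ => by fun_prop)
      (fun _ _ => integrable_const _) false _ ?_
    filter_upwards [mono false] with ω hω
    revert hω
    cases Di false true ω <;> cases hi₀ : Di false false ω <;> cases hp₁ : Dp false true ω <;>
      cases hp₀ : Dp false false ω <;>
      simp [b2r, Set.indicator, hAC, hi₀, hp₁, hp₀]
  have outcome_untreated : cexp P (fun ω => YO ω * (1 - b2r (DiO ω)) * (1 - b2r (DpO ω)))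
      (Zev Zi Zp true true) = ∫ ω in NN, Y false false ω ∂P := by
    rw [← integral_indicator mNN]
    refine (cell (fun a b y => y * (1 - b2r a) * (1 - b2r b)) (fun _ _ => by fun_prop)
      true true).trans (integral_congr_ae (.of_forall fun ω => ?_))
    cases hi : Di true true ω <;> cases hp : Dp true true ω <;>
      simp [b2r, Set.indicator, hNN, hi, hp]
  have untreated : cexp P (fun ω => (1 - b2r (DiO ω)) * (1 - b2r (DpO ω)))
      (Zev Zi Zp true true) = P.real NN := by
    rw [← integral_indicator_one mNN]
    refine (cell (fun a b _ => (1 - b2r a) * (1 - b2r b)) (fun _ _ => by fun_prop)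
      true true).trans (integral_congr_ae (.of_forall fun ω => ?_))
    cases hi : Di true true ω <;> cases hp : Dp true true ω <;>
      simp [b2r, Set.indicator, hNN, hi, hp]
  have hTr : P.real T ≠ 0 := (ENNReal.toReal_pos hTpos.ne' (measure_ne_top _ _)).ne'
  have outcome_ratio : dE P Zi Zp (fun ω => YO ω * b2r (DiO ω)) true true true false / P.real T =
      τ + cexp P (Y true false) PG * (P.real PG / P.real T) := by
    rw [outcome_treated, setIntegral_eq_cexp_mul hTpos, setIntegral_eq_cexp_mul hPGpos, ← hτ,
      add_div, mul_div_cancel_right₀ _ hTr, mul_div_assoc]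
  have hratio : 0 ≤ P.real PG / P.real T := by positivity
  rw [both_treated, outcome_ratio, treated] at hL hU
  rw [outcome_only_own, only_own, neg_div_neg_eq] at hL
  rw [outcome_untreated, untreated] at hU
  refine ⟨fun ⟨_, hle⟩ => ?_, fun ⟨_, hle⟩ => ?_⟩
  · have := mul_le_mul_of_nonneg_right hle hratio
    change L = _ - cexp P (Y true false) AC * _ at hL
    linarith
  · have := mul_le_mul_of_nonneg_right hle hratio
    change U = _ - cexp P (Y false false) NN * _ at hU
    linarith

end
end

section
/- Necessary conditions for the irrelevance assumption (Proposition 2). Assume Assumptions IV, SM and IRR hold. Then for each d ∈ {0,1}: Δ^{1d}_{0d}E[D_i D_{(i)}^∨] ≥ 0, Δ^{1d}_{0d}E[(1−D_i) D_{(i)}^∧] ≤ 0, Δ^{d1}_{d0}E[D_i D_{(i)}^∨] ≤ 0, and Δ^{d1}_{d0}E[(1−D_i) D_{(i)}^∧] ≥ 0. -/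
open MeasureTheory ProbabilityTheory

noncomputable section

variable {Ω : Type*} {m : ℕ}

/-- The event `{Z_i = z, Z_{(i)} = z'}` (all peer instruments equal `z'`). -/
def ZevM (Zi : Ω → Bool) (Zp : Ω → Fin m → Bool) (z z' : Bool) : Set Ω :=
  {ω | Zi ω = z ∧ ∀ j, Zp ω j = z'}

/-- `Δ^{zz'}_{ww'} E[X]`, where `X z z'` is the observed quantity under the
instrument pattern `(z, z')`. -/
def dEM [MeasurableSpace Ω] (P : Measure Ω) (Zi : Ω → Bool) (Zp : Ω → Fin m → Bool)
    (X : Bool → Bool → Ω → ℝ) (z z' w w' : Bool) : ℝ :=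
  cexp P (X z z') (ZevM Zi Zp z z') - cexp P (X w w') (ZevM Zi Zp w w')

/-- Indicator that the individual is treated and no peer is treated. -/
def treatedNoPeer {m : ℕ} (a : Bool) (v : Fin m → Bool) : ℝ :=
  b2r a * ∏ j, (1 - b2r (v j))

/-- Indicator that the individual is untreated and all peers are treated. -/
def untreatedAllPeers {m : ℕ} (a : Bool) (v : Fin m → Bool) : ℝ :=
  (1 - b2r a) * ∏ j, b2r (v j)

lemma treatedNoPeer_eq_ite {m : ℕ} (a : Bool) (v : Fin m → Bool) :
    treatedNoPeer a v = if a = true ∧ ∀ j, v j = false then 1 else 0 := by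
  have h : ∀ b : Bool, 1 - b2r b = if b = false then (1 : ℝ) else 0 := by
    intro b; cases b <;> simp [b2r]
  simp only [treatedNoPeer, h, Finset.prod_ite_zero, Finset.prod_const_one]
  by_cases ha : a = true <;> simp [b2r, ha]

lemma untreatedAllPeers_eq_ite {m : ℕ} (a : Bool) (v : Fin m → Bool) :
    untreatedAllPeers a v = if a = false ∧ ∀ j, v j = true then 1 else 0 := by
  simp only [untreatedAllPeers, b2r, Finset.prod_ite_zero, Finset.prod_const_one]
  cases a <;> simp

lemma treatedNoPeer_le {m : ℕ} {a b : Bool} {v w : Fin m → Bool}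
    (h : (a = true ∧ ∀ j, v j = false) → b = true ∧ ∀ j, w j = false) :
    treatedNoPeer a v ≤ treatedNoPeer b w := by
  rw [treatedNoPeer_eq_ite, treatedNoPeer_eq_ite]
  split_ifs <;> first | exact absurd (h ‹_›) ‹_› | norm_num

lemma untreatedAllPeers_le {m : ℕ} {a b : Bool} {v w : Fin m → Bool}
    (h : (a = false ∧ ∀ j, v j = true) → b = false ∧ ∀ j, w j = true) :
    untreatedAllPeers a v ≤ untreatedAllPeers b w := by
  rw [untreatedAllPeers_eq_ite, untreatedAllPeers_eq_ite]
  split_ifs <;> first | exact absurd (h ‹_›) ‹_› | norm_num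

lemma measurableSet_ZevM [MeasurableSpace Ω] {Zi : Ω → Bool} {Zp : Ω → Fin m → Bool}
    (z z' : Bool) :
    MeasurableSet[MeasurableSpace.comap (fun ω => (Zi ω, Zp ω)) inferInstance]
      (ZevM Zi Zp z z') :=
  ⟨{p | p.1 = z ∧ ∀ j, p.2 j = z'}, Set.Finite.measurableSet (Set.toFinite _), rfl⟩

/-- Conditioning on instruments does not affect the mean of a bounded function of the potential
treatments that are independent of them. -/
lemma cexp_ZevM_eq_integral [MeasurableSpace Ω] {P : Measure Ω} [IsProbabilityMeasure P]
    {Zi : Ω → Bool} {Zp : Ω → Fin m → Bool} (hZi : Measurable Zi) (hZp : Measurable Zp)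
    {𝓦 : Type*} [MeasurableSpace 𝓦] {V : Ω → 𝓦} (hV : Measurable V)
    (hIndep : IndepFun (fun ω => (Zi ω, Zp ω)) V P) {z z' : Bool}
    (hpos : 0 < P (ZevM Zi Zp z z')) {f : 𝓦 → ℝ} (hf : Measurable f) :
    cexp P (fun ω => f (V ω)) (ZevM Zi Zp z z') = ∫ ω, f (V ω) ∂P := by
  have hle : MeasurableSpace.comap (fun ω => (Zi ω, Zp ω)) inferInstance ≤ ‹MeasurableSpace Ω› :=
    (hZi.prodMk hZp).comap_le
  have h := Indep.setIntegral_eq_mul hle hIndep hV.aemeasurable (measurableSet_ZevM z z')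
    hf.aestronglyMeasurable
  have hne : (P (ZevM Zi Zp z z')).toReal ≠ 0 :=
    (ENNReal.toReal_pos hpos.ne' (measure_ne_top _ _)).ne'
  rw [cexp, h, measureReal_def, mul_div_cancel_left₀ _ hne]

/-- Proposition 2: necessary conditions for the irrelevance assumption. -/
theorem irrelevance_necessary_conditions
    [MeasurableSpace Ω] (P : Measure Ω) [IsProbabilityMeasure P]
    (m : ℕ) (hm : 1 ≤ m)
    (Zi : Ω → Bool) (Zp : Ω → Fin m → Bool)
    (Di : Bool → Bool → Ω → Bool) (Dp : Bool → Bool → Ω → Fin m → Bool)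
    (Y : Bool → (Fin m → Bool) → Ω → ℝ)
    (hZi : Measurable Zi) (hZp : Measurable Zp)
    (hDi : ∀ z z', Measurable (Di z z')) (hDp : ∀ z z', Measurable (Dp z z'))
    (hYm : ∀ d dp, Measurable (Y d dp)) (hYint : ∀ d dp, Integrable (Y d dp) P)
    (hZpos : ∀ z z', 0 < P (ZevM Zi Zp z z'))
    -- Assumption IV: independence and own-instrument monotonicity
    (hIndep : IndepFun (fun ω => (Zi ω, Zp ω))
      (fun ω => (fun z z' => Di z z' ω, fun z z' => Dp z z' ω,
        fun d dp => Y d dp ω)) P)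
    (hIV : ∀ᵐ ω ∂P, (∀ z, Di false z ω ≤ Di true z ω) ∧
      ∀ zi j, Dp zi false ω j ≤ Dp zi true ω j)
    -- Assumption SM: monotonicity in the spillovers
    (hSM : ∀ᵐ ω ∂P, (∀ zi, Di zi false ω ≤ Di zi true ω) ∧
      ∀ z j, Dp false z ω j ≤ Dp true z ω j)
    -- Assumption IRR: irrelevance
    (hIRR : ∀ᵐ ω ∂P, (∀ z, Di true z ω = Di false z ω → Dp true z ω = Dp false z ω) ∧
      ∀ zi, Dp zi true ω = Dp zi false ω → Di zi true ω = Di zi false ω)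
    : ∀ d : Bool,
    0 ≤ dEM P Zi Zp (fun z z' ω => b2r (Di z z' ω) *
        ∏ j, (1 - b2r (Dp z z' ω j))) true d false d ∧
    dEM P Zi Zp (fun z z' ω => (1 - b2r (Di z z' ω)) *
        ∏ j, b2r (Dp z z' ω j)) true d false d ≤ 0 ∧
    dEM P Zi Zp (fun z z' ω => b2r (Di z z' ω) *
        ∏ j, (1 - b2r (Dp z z' ω j))) d true d false ≤ 0 ∧
    0 ≤ dEM P Zi Zp (fun z z' ω => (1 - b2r (Di z z' ω)) *
        ∏ j, b2r (Dp z z' ω j)) d true d false := by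
  set V := fun ω => ((fun z z' => Di z z' ω : Bool → Bool → Bool),
    (fun z z' => Dp z z' ω : Bool → Bool → Fin m → Bool),
    (fun d dp => Y d dp ω : Bool → (Fin m → Bool) → ℝ))
  have hV : Measurable V := by fun_prop
  have hD : ∀ z z', Measurable (fun ω => (Di z z' ω, Dp z z' ω)) :=
    fun z z' => (hDi z z').prodMk (hDp z z')
  have hce : ∀ (F : Bool → (Fin m → Bool) → ℝ) (z z' : Bool),
      cexp P (fun ω => F (Di z z' ω) (Dp z z' ω)) (ZevM Zi Zp z z') =
        ∫ ω, F (Di z z' ω) (Dp z z' ω) ∂P := fun F z z' =>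
    cexp_ZevM_eq_integral hZi hZp hV hIndep (hZpos z z')
      (f := fun q => F (q.1 z z') (q.2.1 z z'))
      ((measurable_of_finite (fun p : Bool × (Fin m → Bool) => F p.1 p.2)).comp
        (by fun_prop : Measurable fun q : (Bool → Bool → Bool) × (Bool → Bool → Fin m → Bool) ×
          (Bool → (Fin m → Bool) → ℝ) => (q.1 z z', q.2.1 z z')))
  have hint : ∀ (F : Bool → (Fin m → Bool) → ℝ) (z z' : Bool),
      Integrable (fun ω => F (Di z z' ω) (Dp z z' ω)) P := fun F z z' => by
    exact (Integrable.of_finite (μ := P.map (fun ω => (Di z z' ω, Dp z z' ω)))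
      (f := fun p : Bool × (Fin m → Bool) => F p.1 p.2)).comp_measurable (hD z z')
  have key : ∀ (F : Bool → (Fin m → Bool) → ℝ) (z z' w w' : Bool),
      (∀ᵐ ω ∂P, F (Di w w' ω) (Dp w w' ω) ≤ F (Di z z' ω) (Dp z z' ω)) →
      cexp P (fun ω => F (Di w w' ω) (Dp w w' ω)) (ZevM Zi Zp w w') ≤
        cexp P (fun ω => F (Di z z' ω) (Dp z z' ω)) (ZevM Zi Zp z z') := fun F z z' w w' h => by
    rw [hce, hce]
    exact integral_mono_ae (hint F w w') (hint F z z') h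
  intro d
  refine ⟨sub_nonneg.2 (key treatedNoPeer true d false d ?_),
    sub_nonpos.2 (key untreatedAllPeers false d true d ?_),
    sub_nonpos.2 (key treatedNoPeer d false d true ?_),
    sub_nonneg.2 (key untreatedAllPeers d true d false ?_)⟩
  · filter_upwards [hIV, hIRR] with ω hiv hirr
    refine treatedNoPeer_le fun ⟨ha, hv⟩ => ?_
    have hb : Di true d ω = true := top_le_iff.1 (ha.ge.trans (hiv.1 d))
    exact ⟨hb, by rwa [hirr.1 d (hb.trans ha.symm)]⟩
  · filter_upwards [hIV, hIRR] with ω hiv hirr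
    refine untreatedAllPeers_le fun ⟨ha, hv⟩ => ?_
    have hb : Di false d ω = false := le_bot_iff.1 ((hiv.1 d).trans ha.le)
    exact ⟨hb, by rwa [← hirr.1 d (ha.trans hb.symm)]⟩
  · filter_upwards [hIV, hIRR] with ω hiv hirr
    refine treatedNoPeer_le fun ⟨ha, hv⟩ => ?_
    have hb : ∀ j, Dp d false ω j = false := fun j => le_bot_iff.1 ((hiv.2 d j).trans (hv j).le)
    exact ⟨by rwa [← hirr.2 d (funext fun j => (hv j).trans (hb j).symm)], hb⟩
  · filter_upwards [hIV, hIRR] with ω hiv hirr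
    refine untreatedAllPeers_le fun ⟨ha, hv⟩ => ?_
    have hb : ∀ j, Dp d true ω j = true := fun j => top_le_iff.1 ((hv j).ge.trans (hiv.2 d j))
    exact ⟨by rwa [hirr.2 d (funext fun j => (hb j).trans (hv j).symm)], hb⟩

end
end

section
/- First-stage identity for the no-treated-peers indicator under an own-instrument switch. Assume Assumptions IV, SM and IRR hold. Then Δ^{10}_{00}E[D_{(i)}^∨] = −P(D_i(1,0) > D_i(0,0), D_{(i)}(1,0) ≠ D_{(i)}(0,0) = 0). -/
open MeasureTheory ProbabilityTheory

noncomputable section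

variable {Ω : Type*} {m : ℕ}

theorem prod_one_sub_b2r {n : ℕ} (d : Fin n → Bool) :
    ∏ j, (1 - b2r (d j)) = if d = fun _ => false then 1 else 0 := by
  split_ifs with h
  · simp [h, b2r]
  · obtain ⟨j, hj⟩ := Function.ne_iff.mp h
    exact Finset.prod_eq_zero (Finset.mem_univ j) (by simp [b2r, Bool.eq_true_of_not_eq_false hj])

/-- Conditioning on an instrument event does not change the probability that an independent
treatment vector vanishes. -/
theorem cexp_prod_one_sub_b2r [MeasurableSpace Ω] (P : Measure Ω) [IsProbabilityMeasure P]
    {n : ℕ} {Zi : Ω → Bool} {Zp : Ω → Fin n → Bool} {D : Ω → Fin n → Bool}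
    (hD : Measurable D) (hind : IndepFun (fun ω => (Zi ω, Zp ω)) D P) (z z' : Bool)
    (hpos : 0 < P (ZevM Zi Zp z z')) :
    cexp P (fun ω => ∏ j, (1 - b2r (D ω j))) (ZevM Zi Zp z z') =
      P.real (D ⁻¹' {fun _ => false}) := by
  have hS : MeasurableSet (D ⁻¹' {fun _ => false}) := hD (measurableSet_singleton _)
  have hX : (fun ω => ∏ j, (1 - b2r (D ω j))) = (D ⁻¹' {fun _ => false}).indicator 1 := by
    ext ω
    rw [prod_one_sub_b2r]
    by_cases h : D ω = fun _ => false <;> simp [h]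
  have hZ : ZevM Zi Zp z z' = (fun ω => (Zi ω, Zp ω)) ⁻¹' {(z, fun _ => z')} := by
    ext ω
    simp [ZevM, funext_iff]
  have hmul : P (D ⁻¹' {fun _ => false} ∩ ZevM Zi Zp z z') =
      P (ZevM Zi Zp z z') * P (D ⁻¹' {fun _ => false}) := by
    rw [Set.inter_comm, hZ]
    exact hind.measure_inter_preimage_eq_mul _ _ (measurableSet_singleton _)
      (measurableSet_singleton _)
  have hne : (P (ZevM Zi Zp z z')).toReal ≠ 0 :=
    (ENNReal.toReal_pos hpos.ne' (measure_ne_top _ _)).ne'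
  rw [cexp, hX, integral_indicator_one hS, measureReal_def, Measure.restrict_apply hS, hmul,
    ENNReal.toReal_mul, mul_div_cancel_left₀ _ hne, measureReal_def]

/-- First-stage identity for the no-treated-peers indicator under an own-instrument switch. -/
theorem first_stage_no_treated_peers_own_switch
    [MeasurableSpace Ω] (P : Measure Ω) [IsProbabilityMeasure P]
    (m : ℕ) (hm : 1 ≤ m)
    (Zi : Ω → Bool) (Zp : Ω → Fin m → Bool)
    (Di : Bool → Bool → Ω → Bool) (Dp : Bool → Bool → Ω → Fin m → Bool)
    (Y : Bool → (Fin m → Bool) → Ω → ℝ)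
    (hZi : Measurable Zi) (hZp : Measurable Zp)
    (hDi : ∀ z z', Measurable (Di z z')) (hDp : ∀ z z', Measurable (Dp z z'))
    (hYm : ∀ d dp, Measurable (Y d dp)) (hYint : ∀ d dp, Integrable (Y d dp) P)
    (hZpos : ∀ z z', 0 < P (ZevM Zi Zp z z'))
    -- Assumption IV: independence and own-instrument monotonicity
    (hIndep : IndepFun (fun ω => (Zi ω, Zp ω))
      (fun ω => (fun z z' => Di z z' ω, fun z z' => Dp z z' ω,
        fun d dp => Y d dp ω)) P)
    (hIV : ∀ᵐ ω ∂P, (∀ z, Di false z ω ≤ Di true z ω) ∧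
      ∀ zi j, Dp zi false ω j ≤ Dp zi true ω j)
    -- Assumption SM: monotonicity in the spillovers
    (hSM : ∀ᵐ ω ∂P, (∀ zi, Di zi false ω ≤ Di zi true ω) ∧
      ∀ z j, Dp false z ω j ≤ Dp true z ω j)
    -- Assumption IRR: irrelevance
    (hIRR : ∀ᵐ ω ∂P, (∀ z, Di true z ω = Di false z ω → Dp true z ω = Dp false z ω) ∧
      ∀ zi, Dp zi true ω = Dp zi false ω → Di zi true ω = Di zi false ω)
    :
    dEM P Zi Zp (fun z z' ω => ∏ j, (1 - b2r (Dp z z' ω j))) true false false false =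
      -(P {ω | Di true false ω = true ∧ Di false false ω = false ∧
        Dp true false ω ≠ Dp false false ω ∧
        ∀ j, Dp false false ω j = false}).toReal := by
  have hcexp (z z' : Bool) :
      cexp P (fun ω => ∏ j, (1 - b2r (Dp z z' ω j))) (ZevM Zi Zp z z') =
        P.real (Dp z z' ⁻¹' {fun _ => false}) := by
    refine cexp_prod_one_sub_b2r P (hDp z z') ?_ z z' (hZpos z z')
    exact hIndep.comp (ψ := fun p => p.2.1 z z') measurable_id (by fun_prop)
  have hsub : Dp true false ⁻¹' {fun _ => false} ≤ᵐ[P] Dp false false ⁻¹' {fun _ => false} := by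
    filter_upwards [hSM] with ω hω h
    replace h : Dp true false ω = fun _ => false := h
    funext j
    exact le_bot_iff.mp ((hω.2 false j).trans_eq (congrFun h j))
  have hset : {ω | Di true false ω = true ∧ Di false false ω = false ∧
      Dp true false ω ≠ Dp false false ω ∧ ∀ j, Dp false false ω j = false} =ᵐ[P]
      (Dp false false ⁻¹' {fun _ => false} \ Dp true false ⁻¹' {fun _ => false} : Set Ω) := by
    filter_upwards [hIV, hIRR] with ω hmono hirr
    have hD := hmono.1 false
    have hI := hirr.1 false
    apply propext
    change (Di true false ω = true ∧ Di false false ω = false ∧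
      Dp true false ω ≠ Dp false false ω ∧ ∀ j, Dp false false ω j = false) ↔
      (Dp false false ω = fun _ => false) ∧ ¬ Dp true false ω = fun _ => false
    rw [← funext_iff (f := Dp false false ω) (g := fun _ => false)]
    constructor
    · rintro ⟨-, -, hne, h0⟩
      exact ⟨h0, fun h1 => hne (h1.trans h0.symm)⟩
    · rintro ⟨h0, h1⟩
      have hne : Dp true false ω ≠ Dp false false ω := fun h => h1 (h.trans h0)
      have hDne : Di true false ω ≠ Di false false ω := fun h => hne (hI h)
      revert hD hDne
      cases Di true false ω <;> cases Di false false ω <;> simp [h0, h1]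
  have hm1 := hDp true false (measurableSet_singleton (fun _ => false))
  have hdiff := measureReal_sdiff_add_inter (μ := P)
    (s := Dp false false ⁻¹' {fun _ => false}) hm1
  have hinter : (Dp false false ⁻¹' {fun _ => false} ∩ Dp true false ⁻¹' {fun _ => false} : Set Ω)
      =ᵐ[P] Dp true false ⁻¹' {fun _ => false} := by
    filter_upwards [hsub] with ω hω
    exact propext ⟨fun h => h.2, fun h => ⟨hω h, h⟩⟩
  rw [measureReal_congr hinter] at hdiff
  rw [dEM, hcexp, hcexp, ← measureReal_def, measureReal_congr hset]
  linarith

end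
end
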